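/- arXiv:1703.07572 — 2 statements merged into one kernel-verified Lean document; each statement's English description precedes it below -/
import Mathlib

section
/- Let T > 0, let φ : ℝ × ℝ → ℝ be continuous and 2π-periodic in its second variable, and let x, y : [0, T] → ℝ be continuous functions. Define the averaged function φ̄(x) = (1/(2π)) ∫_0^{2π} φ(x, θ) dθ. Then lim_{λ → +∞} ∫_0^T φ(x(s), λ·s + y(s)) ds = ∫_0^T φ̄(x(s)) ds. -/
open Real Filter intervalIntegral

lemma avg_bound (ψ : ℝ × ℝ → ℝ) (hψ : Continuous ψ)
    (hper : ∀ s θ : ℝ, ψ (s, θ + 2 * Real.pi) = ψ (s, θ)) (a b : ℝ) :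
    ∃ M : ℝ, 0 ≤ M ∧ ∀ s ∈ Set.Icc a b, ∀ θ, |ψ (s, θ)| ≤ M := by
  have hc : IsCompact (Set.Icc a b ×ˢ Set.Icc (0:ℝ) (2 * Real.pi)) := isCompact_Icc.prod isCompact_Icc
  obtain ⟨M, hM⟩ := hc.exists_bound_of_continuousOn hψ.continuousOn
  refine ⟨max M 0, le_max_right _ _, fun s hs θ => ?_⟩
  have hp : Function.Periodic (fun θ => ψ (s, θ)) (2 * Real.pi) := fun θ => hper s θ
  obtain ⟨t, ht, h⟩ := hp.exists_mem_Ico₀ Real.two_pi_pos θ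
  rw [h]
  exact (hM (s, t) ⟨hs, Set.Ico_subset_Icc_self ht⟩).trans (le_max_left _ _)

lemma avg_unif (ψ : ℝ × ℝ → ℝ) (hψ : Continuous ψ)
    (hper : ∀ s θ : ℝ, ψ (s, θ + 2 * Real.pi) = ψ (s, θ)) (a b : ℝ) (ε : ℝ) (hε : 0 < ε) :
    ∃ δ > 0, ∀ s ∈ Set.Icc a b, ∀ t ∈ Set.Icc a b, |s - t| < δ →
      ∀ θ, |ψ (s, θ) - ψ (t, θ)| ≤ ε := by
  have hc : IsCompact (Set.Icc a b ×ˢ Set.Icc (0:ℝ) (2 * Real.pi)) := isCompact_Icc.prod isCompact_Icc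
  have hu := hc.uniformContinuousOn_of_continuous hψ.continuousOn
  rw [Metric.uniformContinuousOn_iff] at hu
  obtain ⟨δ, hδ, h⟩ := hu ε hε
  refine ⟨δ, hδ, fun s hs t ht hst θ => ?_⟩
  have hp : Function.Periodic (fun θ => (ψ (s, θ) - ψ (t, θ))) (2 * Real.pi) := by
    intro θ
    simp only [hper]
  obtain ⟨r, hr, h'⟩ := hp.exists_mem_Ico₀ Real.two_pi_pos θ
  rw [h']
  have hr' := Set.Ico_subset_Icc_self hr
  have := h (s, r) ⟨hs, hr'⟩ (t, r) ⟨ht, hr'⟩ (by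
    simp [Prod.dist_eq, Real.dist_eq, hst, hδ])
  rw [Real.dist_eq] at this
  exact this.le

lemma avg_shift (ψ : ℝ × ℝ → ℝ) (hψ : Continuous ψ) (T : ℝ) (hT : 0 < T)
    (M ε d lam : ℝ) (hd : 0 ≤ d) (hd1 : d ≤ 1)
    (hM : ∀ s ∈ Set.Icc (-1) (T + 1), ∀ θ, |ψ (s, θ)| ≤ M)
    (hu : ∀ s ∈ Set.Icc 0 T, ∀ θ, |ψ (s - d, θ) - ψ (s, θ)| ≤ ε) :
    |(∫ s in (0:ℝ)..T, ψ (s, lam * s + lam * d)) - ∫ s in (0:ℝ)..T, ψ (s, lam * s)|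
      ≤ ε * T + 2 * M * d := by
  have hg : Continuous (fun s : ℝ => ψ (s - d, lam * s)) := by fun_prop
  have hf : Continuous (fun s : ℝ => ψ (s, lam * s)) := by fun_prop
  have h1 : (∫ s in (0:ℝ)..T, ψ (s, lam * s + lam * d))
      = ∫ s in (0 + d)..(T + d), ψ (s - d, lam * s) := by
    rw [← intervalIntegral.integral_comp_add_right (fun s => ψ (s - d, lam * s))]
    congr 1
    ext s
    simp [mul_add]
  have hi : ∀ a b : ℝ, IntervalIntegrable (fun s : ℝ => ψ (s - d, lam * s)) MeasureTheory.volume a b :=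
    fun a b => hg.intervalIntegrable a b
  have h2 := intervalIntegral.integral_add_adjacent_intervals (hi 0 d) (hi d (T + d))
  have h3 := intervalIntegral.integral_add_adjacent_intervals (hi 0 T) (hi T (T + d))
  have h4 := intervalIntegral.integral_sub (hi 0 T) (hf.intervalIntegrable 0 T)
  have b1 := intervalIntegral.norm_integral_le_of_norm_le_const (a := 0) (b := T) (C := ε)
    (f := fun s => ψ (s - d, lam * s) - ψ (s, lam * s)) (by
      intro s hs
      rw [Set.uIoc_of_le hT.le] at hs
      exact hu s ⟨hs.1.le, hs.2⟩ _)
  have b2 := intervalIntegral.norm_integral_le_of_norm_le_const (a := 0) (b := d) (C := M)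
    (f := fun s => ψ (s - d, lam * s)) (by
      intro s hs
      rw [Set.uIoc_of_le hd] at hs
      exact hM _ ⟨by linarith [hs.1], by linarith [hs.2]⟩ _)
  have b3 := intervalIntegral.norm_integral_le_of_norm_le_const (a := T) (b := T + d) (C := M)
    (f := fun s => ψ (s - d, lam * s)) (by
      intro s hs
      rw [Set.uIoc_of_le (by linarith)] at hs
      exact hM _ ⟨by linarith [hs.1], by linarith [hs.2]⟩ _)
  rw [Real.norm_eq_abs] at b1 b2 b3
  rw [sub_zero, abs_of_pos hT] at b1
  rw [sub_zero, abs_of_nonneg hd] at b2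
  rw [add_sub_cancel_left, abs_of_nonneg hd] at b3
  rw [h1, zero_add]
  rw [abs_le] at *
  constructor <;> linarith [b1.1, b1.2, b2.1, b2.2, b3.1, b3.2]

lemma avg_main (ψ : ℝ × ℝ → ℝ) (hψ : Continuous ψ) (T : ℝ) (hT : 0 < T)
    (hper : ∀ s θ : ℝ, ψ (s, θ + 2 * Real.pi) = ψ (s, θ)) :
    Tendsto (fun lam : ℝ => ∫ s in (0 : ℝ)..T, ψ (s, lam * s)) atTop
      (nhds (∫ s in (0 : ℝ)..T,
        (1 / (2 * Real.pi)) * ∫ θ in (0 : ℝ)..(2 * Real.pi), ψ (s, θ))) := by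
  have hpi := Real.two_pi_pos
  obtain ⟨M, hM0, hM⟩ := avg_bound ψ hψ hper (-1) (T + 1)
  rw [Metric.tendsto_atTop]
  intro ε hε
  obtain ⟨δ, hδ, hu⟩ := avg_unif ψ hψ hper (-1) (T + 1) (ε / (4 * T)) (by positivity)
  -- the admissible size of the shift
  obtain ⟨η, hη, hη1, hηδ, hηM⟩ : ∃ η : ℝ, 0 < η ∧ η ≤ 1 ∧ η < δ ∧ 2 * M * η ≤ ε / 4 := by
    refine ⟨min 1 (min (δ / 2) (ε / (8 * (M + 1)))), by positivity, min_le_left _ _, ?_, ?_⟩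
    · exact ((min_le_right _ _).trans (min_le_left _ _)).trans_lt (by linarith)
    · have h : min 1 (min (δ / 2) (ε / (8 * (M + 1)))) ≤ ε / (8 * (M + 1)) :=
        (min_le_right _ _).trans (min_le_right _ _)
      calc _ ≤ 2 * (M + 1) * (ε / (8 * (M + 1))) := by gcongr; linarith
        _ = ε / 4 := by field_simp; norm_num
  refine ⟨2 * Real.pi / η, fun lam hlam => ?_⟩
  have hlam0 : 0 < lam := lt_of_lt_of_le (by positivity) hlam
  have key : ∀ u ∈ Set.Icc 0 (2 * Real.pi),
      |(∫ s in (0:ℝ)..T, ψ (s, lam * s + u)) - ∫ s in (0:ℝ)..T, ψ (s, lam * s)| ≤ ε / 2 := by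
    intro u hu'
    have hd0 : 0 ≤ u / lam := div_nonneg hu'.1 hlam0.le
    have hdη : u / lam ≤ η := by
      rw [div_le_iff₀ hlam0]
      rw [ge_iff_le, div_le_iff₀ hη] at hlam
      linarith [hu'.2]
    have := avg_shift ψ hψ T hT M (ε / (4 * T)) (u / lam) lam hd0 (hdη.trans hη1) hM (by
      intro s hs θ
      refine hu _ ⟨by linarith [hs.1], by linarith [hs.2]⟩ _
        ⟨by linarith [hs.1], by linarith [hs.2]⟩ ?_ θ
      rw [show s - u / lam - s = -(u / lam) by ring, abs_neg, abs_of_nonneg hd0]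
      linarith)
    rw [mul_div_cancel₀ _ hlam0.ne'] at this
    refine this.trans ?_
    have e1 : ε / (4 * T) * T = ε / 4 := by field_simp
    have e2 : 2 * M * (u / lam) ≤ 2 * M * η := by gcongr
    linarith
  set I := ∫ s in (0:ℝ)..T, ψ (s, lam * s) with hI
  have hG : Continuous (fun u : ℝ => ∫ s in (0:ℝ)..T, ψ (s, lam * s + u)) := by
    apply intervalIntegral.continuous_parametric_intervalIntegral_of_continuous'
    fun_prop
  have hswap : (∫ u in (0:ℝ)..(2 * Real.pi), ∫ s in (0:ℝ)..T, ψ (s, lam * s + u))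
      = ∫ s in (0:ℝ)..T, ∫ θ in (0:ℝ)..(2 * Real.pi), ψ (s, θ) := by
    have hcont : Continuous (Function.uncurry fun u s : ℝ => ψ (s, lam * s + u)) := by
      unfold Function.uncurry
      fun_prop
    have hsw : (∫ u in (0:ℝ)..(2 * Real.pi), ∫ s in (0:ℝ)..T, ψ (s, lam * s + u))
        = ∫ s in (0:ℝ)..T, ∫ u in (0:ℝ)..(2 * Real.pi), ψ (s, lam * s + u) := by
      simp only [intervalIntegral.integral_of_le hT.le, intervalIntegral.integral_of_le hpi.le]
      apply MeasureTheory.integral_integral_swap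
      rw [MeasureTheory.Measure.prod_restrict]
      exact (hcont.continuousOn.integrableOn_compact
        (isCompact_Icc.prod isCompact_Icc)).mono_set
        (Set.prod_mono Set.Ioc_subset_Icc_self Set.Ioc_subset_Icc_self)
    rw [hsw]
    apply intervalIntegral.integral_congr
    intro s _
    have hp : Function.Periodic (fun θ => ψ (s, θ)) (2 * Real.pi) := fun θ => hper _ θ
    simp only
    rw [intervalIntegral.integral_comp_add_left (fun θ => ψ (s, θ)), add_zero,
      hp.intervalIntegral_add_eq (lam * s) 0, zero_add]
  have hb := intervalIntegral.norm_integral_le_of_norm_le_const (a := 0) (b := 2 * Real.pi)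
    (C := ε / 2) (f := fun u => (∫ s in (0:ℝ)..T, ψ (s, lam * s + u)) - I) (by
      intro u hu'
      rw [Set.uIoc_of_le hpi.le] at hu'
      exact key u ⟨hu'.1.le, hu'.2⟩)
  rw [intervalIntegral.integral_sub (hG.intervalIntegrable _ _) (by simp), hswap,
    intervalIntegral.integral_const, smul_eq_mul, sub_zero, abs_of_pos hpi, Real.norm_eq_abs] at hb
  rw [intervalIntegral.integral_const_mul, dist_comm, Real.dist_eq]
  set J := ∫ s in (0:ℝ)..T, ∫ θ in (0:ℝ)..(2 * Real.pi), ψ (s, θ)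
  have : 1 / (2 * Real.pi) * J - I = (1 / (2 * Real.pi)) * (J - 2 * Real.pi * I) := by
    field_simp
  rw [this, abs_mul, abs_of_pos (by positivity)]
  calc _ ≤ 1 / (2 * Real.pi) * (ε / 2 * (2 * Real.pi)) := by gcongr
    _ = ε / 2 := by field_simp
    _ < ε := by linarith

/-- Deterministic averaging principle: if `φ` is continuous and `2π`-periodic in its
second variable and `x, y` are continuous paths on `[0, T]`, then
`∫_0^T φ(x(s), λ s + y(s)) ds → ∫_0^T φ̄(x(s)) ds` as `λ → ∞`, where
`φ̄(x) = (1/2π) ∫_0^{2π} φ(x, θ) dθ`. -/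
theorem deterministic_averaging_principle
    (T : ℝ) (hT : 0 < T)
    (φ : ℝ × ℝ → ℝ) (hφ : Continuous φ)
    (hper : ∀ x θ : ℝ, φ (x, θ + 2 * Real.pi) = φ (x, θ))
    (x y : ℝ → ℝ)
    (hx : ContinuousOn x (Set.Icc 0 T)) (hy : ContinuousOn y (Set.Icc 0 T)) :
    Tendsto
      (fun lam : ℝ => ∫ s in (0 : ℝ)..T, φ (x s, lam * s + y s))
      atTop
      (nhds (∫ s in (0 : ℝ)..T,
        (1 / (2 * Real.pi)) * ∫ θ in (0 : ℝ)..(2 * Real.pi), φ (x s, θ))) := by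
  have hX : Continuous (Set.IccExtend hT.le (Set.domRestrict (Set.Icc 0 T) x)) :=
    (continuousOn_iff_continuous_domRestrict.1 hx).Icc_extend'
  have hY : Continuous (Set.IccExtend hT.le (Set.domRestrict (Set.Icc 0 T) y)) :=
    (continuousOn_iff_continuous_domRestrict.1 hy).Icc_extend'
  set X := Set.IccExtend hT.le (Set.domRestrict (Set.Icc 0 T) x) with hXd
  set Y := Set.IccExtend hT.le (Set.domRestrict (Set.Icc 0 T) y) with hYd
  have hXe : ∀ s ∈ Set.Icc 0 T, X s = x s := fun s hs => by
    rw [hXd, Set.IccExtend_of_mem _ _ hs]; rfl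
  have hYe : ∀ s ∈ Set.Icc 0 T, Y s = y s := fun s hs => by
    rw [hYd, Set.IccExtend_of_mem _ _ hs]; rfl
  have h := avg_main (fun p => φ (X p.1, p.2 + Y p.1)) (by fun_prop) T hT (by
    intro s θ
    simp only
    rw [show θ + 2 * Real.pi + Y s = θ + Y s + 2 * Real.pi by ring, hper])
  simp only at h
  convert h using 1
  · ext lam
    apply intervalIntegral.integral_congr
    intro s hs
    rw [Set.uIcc_of_le hT.le] at hs
    simp only [hXe s hs, hYe s hs]
  · congr 1
    apply intervalIntegral.integral_congr
    intro s hs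
    rw [Set.uIcc_of_le hT.le] at hs
    simp only [hXe s hs]
    congr 1
    have hp : Function.Periodic (fun θ => φ (x s, θ)) (2 * Real.pi) := fun θ => hper _ θ
    rw [intervalIntegral.integral_comp_add_right (fun θ => φ (x s, θ)), zero_add,
      add_comm (2 * Real.pi), hp.intervalIntegral_add_eq (Y s) 0, zero_add]
end

section
/- Let γ ∈ (0,1) and J₁₁, J₁₂, J₂₁, J₂₂ ∈ ℝ satisfy γJ₁₁ − 1 = −((1−γ)J₂₂ − 1) and Γ := (γJ₁₁ − 1)² + γ(1−γ)J₁₂J₂₁ < 0. Then the Jacobian matrix at (0,0) of the vector field F(m₁, m₂) = (2γ sinh(J₁₁m₁ + J₁₂m₂) − 2m₁ cosh(J₁₁m₁ + J₁₂m₂), 2(1−γ) sinh(J₂₁m₁ + J₂₂m₂) − 2m₂ cosh(J₂₁m₁ + J₂₂m₂)) equals A_cr = [[2(γJ₁₁ − 1), 2γJ₁₂], [2(1−γ)J₂₁, −2(γJ₁₁ − 1)]], and the eigenvalues of A_cr over ℂ are the purely imaginary numbers ±2i√|Γ| (equivalently, the characteristic polynomial of A_cr is X² + 4|Γ|). -/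
open Matrix Polynomial

/-- Under the critical conditions of the two-population Curie-Weiss model, the Jacobian
at the origin of the macroscopic vector field is
`A_cr = [[2(γJ₁₁−1), 2γJ₁₂], [2(1−γ)J₂₁, −2(γJ₁₁−1)]]`, whose characteristic polynomial
is `X² + 4|Γ|` and whose eigenvalues over `ℂ` are `± 2i√|Γ|`. -/
theorem two_population_CW_critical_jacobian
    (γ J11 J12 J21 J22 : ℝ) (hγ : γ ∈ Set.Ioo (0 : ℝ) 1)
    (hcrit : γ * J11 - 1 = -((1 - γ) * J22 - 1))
    (Γ : ℝ) (hΓdef : Γ = (γ * J11 - 1) ^ 2 + γ * (1 - γ) * J12 * J21)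
    (hΓ : Γ < 0)
    (A : Matrix (Fin 2) (Fin 2) ℝ)
    (hA : A = !![2 * (γ * J11 - 1), 2 * γ * J12;
                 2 * (1 - γ) * J21, -(2 * (γ * J11 - 1))])
    (F : (Fin 2 → ℝ) → (Fin 2 → ℝ))
    (hF : F = fun v =>
      ![2 * γ * Real.sinh (J11 * v 0 + J12 * v 1) -
          2 * v 0 * Real.cosh (J11 * v 0 + J12 * v 1),
        2 * (1 - γ) * Real.sinh (J21 * v 0 + J22 * v 1) -
          2 * v 1 * Real.cosh (J21 * v 0 + J22 * v 1)]) :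
    HasFDerivAt F (LinearMap.toContinuousLinearMap (Matrix.toLin' A)) ![0, 0] ∧
    A.charpoly = X ^ 2 + C (4 * |Γ|) ∧
    spectrum ℂ (A.map (Complex.ofReal)) =
      {2 * Real.sqrt |Γ| * Complex.I, -(2 * Real.sqrt |Γ| * Complex.I)} := by
  have habs : |Γ| = -Γ := abs_of_neg hΓ
  refine ⟨?_, ?_, ?_⟩
  · subst hF
    rw [hasFDerivAt_pi']
    have h0 : HasFDerivAt (fun v : Fin 2 → ℝ => v 0)
        (ContinuousLinearMap.proj (R := ℝ) (φ := fun _ : Fin 2 => ℝ) 0) ![0, 0] :=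
      hasFDerivAt_apply 0 _
    have h1 : HasFDerivAt (fun v : Fin 2 → ℝ => v 1)
        (ContinuousLinearMap.proj (R := ℝ) (φ := fun _ : Fin 2 => ℝ) 1) ![0, 0] :=
      hasFDerivAt_apply 1 _
    have hR1 := (h0.const_mul J11).add (h1.const_mul J12)
    have hR2 := (h0.const_mul J21).add (h1.const_mul J22)
    intro i
    fin_cases i
    · have h := (hR1.sinh.const_mul (2 * γ)).sub ((h0.const_mul 2).mul hR1.cosh)
      refine HasFDerivAt.congr_fderiv h ?_
      ext j
      simp [hA, Matrix.toLin'_apply, Matrix.mulVec, dotProduct, Fin.sum_univ_two]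
      ring
    · have h := (hR2.sinh.const_mul (2 * (1 - γ))).sub ((h1.const_mul 2).mul hR2.cosh)
      refine HasFDerivAt.congr_fderiv h ?_
      ext j
      simp [hA, Matrix.toLin'_apply, Matrix.mulVec, dotProduct, Fin.sum_univ_two]
      linear_combination (2 * j 1) * hcrit
  · rw [Matrix.charpoly_fin_two, hA, habs, hΓdef, Matrix.trace_fin_two, Matrix.det_fin_two]
    simp only [Matrix.of_apply, Matrix.cons_val', Matrix.cons_val_zero, Matrix.cons_val_one,
      Matrix.cons_val_fin_one, add_neg_cancel, map_zero, zero_mul, sub_zero]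
    congr 2
    ring
  · have hs : ((Real.sqrt |Γ| : ℝ) : ℂ) ^ 2 = -(((γ : ℂ) * J11 - 1) ^ 2 + γ * (1 - γ) * J12 * J21) := by
      rw [← Complex.ofReal_pow, Real.sq_sqrt (abs_nonneg _), habs, hΓdef]
      push_cast
      ring
    ext z
    rw [spectrum.mem_iff, Matrix.isUnit_iff_isUnit_det, isUnit_iff_ne_zero, not_not,
      Matrix.det_fin_two, Set.mem_insert_iff, Set.mem_singleton_iff]
    simp only [hA, Matrix.sub_apply, Matrix.algebraMap_matrix_apply, Matrix.map_apply]
    simp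
    generalize ((Real.sqrt |Γ| : ℝ) : ℂ) = s at *
    have hI := Complex.I_sq
    rw [← sub_eq_zero (a := z) (b := 2 * s * Complex.I), ← sub_eq_zero (a := z) (b := -(2 * s * Complex.I)), ← mul_eq_zero]
    apply Eq.congr_left
    linear_combination (4 * s ^ 2) * hI - 4 * hs
end
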